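/- Assume T = Σ_{(u,v)∈E} A(u,v) > 0. Sample m ≥ 1 i.i.d. hyperedges, where one hyperedge is generated by drawing g ∼ μ and an edge (u,v) with probability A(u,v)/T (independently) and recording the pair (R_{g^T}(u), R_{g^T}(v)). For a seed set S ⊆ V, let D(S) be the number of sampled hyperedges (N1, N2) with S ∩ N1 ≠ ∅ and S ∩ N2 ≠ ∅ (fully covered hyperedges). Then T · D(S)/m is an unbiased estimator of the activity: E[ T · D(S)/m ] = δ_A(S). -/

import Mathlib

open scoped Classical
open Finset

noncomputable section

/-- The set of vertices reachable from the seed set `S` along edges of `g`. -/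
def reach {V : Type*} [Fintype V] (g : Finset (V × V)) (S : Finset V) : Finset V :=
  Finset.univ.filter fun v => ∃ u ∈ S, Relation.ReflTransGen (fun a b => (a, b) ∈ g) u v

/-- The transpose graph `g^T`: `(u,v) ∈ g` iff `(v,u) ∈ g^T`. -/
def transpose {V : Type*} (g : Finset (V × V)) : Finset (V × V) := g.image Prod.swap

/-- The activity `δ_A(S)` of a seed set `S`. -/
def deltaA {V : Type*} [Fintype V] (E : Finset (V × V)) (A : V × V → ℝ)
    (μ : Finset (V × V) → ℝ) (S : Finset V) : ℝ :=
  ∑ g ∈ E.powerset, μ g *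
    ∑ e ∈ E.filter (fun e => e.1 ∈ reach g S ∧ e.2 ∈ reach g S), A e

/-- `D(S)` : the number of the `m` sampled hyperedges
`(R_{g^T}(u), R_{g^T}(v))`, for samples `ω i = (g, (u, v))`, fully covered by `S`. -/
def D {V : Type*} [Fintype V] (m : ℕ) (ω : Fin m → Finset (V × V) × (V × V))
    (S : Finset V) : ℕ :=
  (Finset.univ.filter fun i : Fin m =>
    (S ∩ reach (transpose (ω i).1) {(ω i).2.1}).Nonempty ∧
    (S ∩ reach (transpose (ω i).1) {(ω i).2.2}).Nonempty).card

theorem reflTransGen_transpose_iff {V : Type*} (g : Finset (V × V)) (u v : V) :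
    Relation.ReflTransGen (fun a b => (a, b) ∈ transpose g) u v ↔
      Relation.ReflTransGen (fun a b => (a, b) ∈ g) v u := by
  have h : (fun a b => (a, b) ∈ transpose g) = Function.swap fun a b => (a, b) ∈ g := by
    ext a b
    simp [transpose, Function.swap]
  rw [h, Relation.reflTransGen_swap]

theorem inter_reach_transpose_nonempty_iff {V : Type*} [Fintype V]
    (g : Finset (V × V)) (S : Finset V) (u : V) :
    (S ∩ reach (transpose g) {u}).Nonempty ↔ u ∈ reach g S := by
  simp [Finset.Nonempty, reach, reflTransGen_transpose_iff]

/-- The marginal of one coordinate under a finite product of identical weights of total mass one. -/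
theorem sum_prod_mul_apply {ι Ω R : Type*} [Fintype ι] [DecidableEq ι] [Fintype Ω] [CommSemiring R]
    (p f : Ω → R) (hp : ∑ x, p x = 1) (j : ι) :
    ∑ ω : ι → Ω, (∏ i, p (ω i)) * f (ω j) = ∑ x, p x * f x := by
  have h := Finset.prod_univ_sum (fun _ : ι => (Finset.univ : Finset Ω))
    (fun i x => p x * if i = j then f x else 1)
  simp only [Fintype.piFinset_univ, Finset.prod_mul_distrib, Finset.prod_ite_eq',
    Finset.mem_univ, if_true] at h
  rw [← h, Finset.prod_eq_single j]
  · simp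
  · intro i _ hij
    simp [hij, hp]
  · simp

/-- The empirical mean of i.i.d. samples is unbiased. -/
theorem sum_prod_mul_mean {Ω : Type*} [Fintype Ω] (p f : Ω → ℝ) (hp : ∑ x, p x = 1)
    {m : ℕ} (hm : m ≠ 0) :
    ∑ ω : Fin m → Ω, (∏ i, p (ω i)) * ((∑ i, f (ω i)) / m) = ∑ x, p x * f x := by
  have hm0 : (m : ℝ) ≠ 0 := Nat.cast_ne_zero.mpr hm
  simp only [← mul_div_assoc, ← Finset.sum_div, Finset.mul_sum]
  rw [Finset.sum_comm]
  simp only [sum_prod_mul_apply p f hp]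
  simp [hm0]

/-- `T · D(S)/m` is an unbiased estimator of `δ_A(S)`: the expectation over `m`
i.i.d. hyperedge samples (each drawn as `g ∼ μ` and an edge with probability `A e / T`)
of `T · D(S)/m` equals the activity `δ_A(S)`. -/
theorem unbiased_estimator {V : Type*} [Fintype V]
    (E : Finset (V × V)) (A : V × V → ℝ) (μ : Finset (V × V) → ℝ)
    (hA : ∀ e ∈ E, 0 ≤ A e) (hA0 : ∀ e ∉ E, A e = 0)
    (hμ : ∀ g, 0 ≤ μ g) (hμ0 : ∀ g, ¬ g ⊆ E → μ g = 0)
    (hμ1 : ∑ g ∈ E.powerset, μ g = 1)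
    (hT : 0 < ∑ e ∈ E, A e)
    (m : ℕ) (hm : 1 ≤ m) (S : Finset V) :
    ∑ ω : Fin m → Finset (V × V) × (V × V),
      (∏ i : Fin m, μ (ω i).1 * (A (ω i).2 / ∑ e ∈ E, A e)) *
        ((∑ e ∈ E, A e) * (D m ω S : ℝ) / (m : ℝ))
      = deltaA E A μ S := by
  set T := ∑ e ∈ E, A e with hTdef
  have hAT : ∑ e, A e = T :=
    (Finset.sum_subset (Finset.subset_univ E) fun e _ he => hA0 e he).symm
  have hμT : ∑ g, μ g = 1 := hμ1 ▸
    (Finset.sum_subset (Finset.subset_univ E.powerset)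
      fun g _ hg => hμ0 g (by simpa using hg)).symm
  let p : Finset (V × V) × (V × V) → ℝ := fun x => μ x.1 * (A x.2 / T)
  let f : Finset (V × V) × (V × V) → ℝ := fun x =>
    if x.2.1 ∈ reach x.1 S ∧ x.2.2 ∈ reach x.1 S then T else 0
  have hp : ∑ x, p x = 1 := by
    simp only [p, Fintype.sum_prod_type, ← Finset.mul_sum, ← Finset.sum_div, hAT,
      div_self hT.ne', mul_one, hμT]
  have hD (ω : Fin m → Finset (V × V) × (V × V)) : T * (D m ω S : ℝ) = ∑ i, f (ω i) := by
    simp only [D, inter_reach_transpose_nonempty_iff, f, ← Finset.sum_filter,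
      Finset.sum_const, nsmul_eq_mul, mul_comm]
  simp only [hD]
  refine (sum_prod_mul_mean p f hp (Nat.one_le_iff_ne_zero.mp hm)).trans ?_
  rw [Fintype.sum_prod_type, deltaA]
  symm
  refine (Finset.sum_subset (Finset.subset_univ _) fun g _ hg => ?_).trans
    (Finset.sum_congr rfl fun g _ => ?_)
  · rw [hμ0 g (by simpa using hg), zero_mul]
  · rw [Finset.sum_filter, Finset.mul_sum]
    refine (Finset.sum_subset (Finset.subset_univ _) fun e _ he => ?_).trans
      (Finset.sum_congr rfl fun e _ => ?_)
    · simp [hA0 e he]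
    · simp only [p, f]
      split_ifs
      · field_simp
      · simp
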